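/- In the scalar case n = 1, set λ = |L|·H_m and Δ = [Q*_M + (H_M/2)(σ + a)²]·2|L|/a, and suppose σ > σ₀ > 0 and ε* > 0 satisfy λε* < 1, ε*·|L|·H_M ≤ 1, and σ₀ + ε*Δ(T−1)(7a + 2σ)/(2a) < σ. Then for every ε ∈ (0, ε*] and every solution θ̃ of the scalar discrete-time extremum-seeking error system with |θ̃(0)| ≤ σ₀, one has |θ̃(k)| < |θ̃(0)| + ε(T−1)Δ for k ∈ {0,…,T−1}, and |θ̃(k)| < (1−λε)^{k−T+1}(|θ̃(0)| + 3(T−1)εΔ/2) + εΔ(T−1)(2a + σ)/a < σ for all k ≥ T−1. -/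

import Mathlib

open Real

/-- The sum of a `T`-periodic sequence over a window of length `T` does not depend on the window. -/
lemma sum_range_window_of_periodic {f : ℕ → ℝ} {T : ℕ} (hf : ∀ i, f (i + T) = f i) (n : ℕ) :
    ∑ i ∈ Finset.range T, f (n + i) = ∑ i ∈ Finset.range T, f i := by
  induction n with
  | zero => simp
  | succ n ih =>
    have h := Finset.sum_range_succ (fun i => f (n + i)) T
    rw [Finset.sum_range_succ'] at h
    simp only [add_zero, hf] at h
    rw [← ih, ← add_right_cancel h]
    exact Finset.sum_congr rfl fun i _ => by congr 1; ring

/-- A sequence that is odd with respect to reflection in its period sums to zero over a period. -/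
lemma sum_range_eq_zero_of_periodic_of_odd {f : ℕ → ℝ} {T : ℕ} (hf : ∀ i, f (i + T) = f i)
    (hodd : ∀ i ≤ T, f (T - i) = -f i) : ∑ i ∈ Finset.range T, f i = 0 := by
  have h₁ := sum_range_window_of_periodic hf 1
  rw [← Finset.sum_range_reflect] at h₁
  have h₂ : ∑ i ∈ Finset.range T, f (1 + (T - 1 - i)) = ∑ i ∈ Finset.range T, -f i := by
    refine Finset.sum_congr rfl fun i hi => ?_
    have hi' := Finset.mem_range.1 hi
    rw [← hodd i hi'.le]
    congr 1
    omega
  rw [h₂, Finset.sum_neg_distrib] at h₁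
  linarith

/-- The sinusoidal dither with `α` oscillations per `T` samples. -/
noncomputable def dither (α : ℤ) (T : ℕ) (i : ℕ) : ℝ := Real.sin (2 * π * α * i / T)

lemma abs_dither_le_one (α : ℤ) (T i : ℕ) : |dither α T i| ≤ 1 := Real.abs_sin_le_one _

lemma dither_zero (α : ℤ) (T : ℕ) : dither α T 0 = 0 := by simp [dither]

lemma dither_add_period (α : ℤ) {T : ℕ} (hT : 0 < T) (i : ℕ) :
    dither α T (i + T) = dither α T i := by
  have hT' : (T : ℝ) ≠ 0 := by positivity
  unfold dither
  rw [← Real.sin_add_int_mul_two_pi (2 * π * α * i / T) α]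
  congr 1
  push_cast
  field_simp

lemma dither_reflect (α : ℤ) {T : ℕ} (hT : 0 < T) {i : ℕ} (hi : i ≤ T) :
    dither α T (T - i) = -dither α T i := by
  have hT' : (T : ℝ) ≠ 0 := by positivity
  unfold dither
  rw [← Real.sin_int_mul_two_pi_sub (2 * π * α * i / T) α]
  congr 1
  push_cast [hi]
  field_simp

lemma sum_dither_pow_of_odd (α : ℤ) {T : ℕ} (hT : 0 < T) {p : ℕ} (hp : Odd p) (n : ℕ) :
    ∑ i ∈ Finset.range T, dither α T (n + i) ^ p = 0 := by
  have hper : ∀ i, dither α T (i + T) ^ p = dither α T i ^ p := fun i => by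
    rw [dither_add_period α hT]
  rw [sum_range_window_of_periodic (f := fun i => dither α T i ^ p) hper]
  refine sum_range_eq_zero_of_periodic_of_odd hper fun i hi => ?_
  rw [dither_reflect α hT hi, hp.neg_pow]

lemma sum_dither_sq {α : ℤ} {T : ℕ} (hT : 0 < T) (hα : α ≠ 0) (hαT : |2 * (α : ℝ) / T| < 1)
    (n : ℕ) : ∑ i ∈ Finset.range T, dither α T (n + i) ^ 2 = T / 2 := by
  have hT' : (T : ℝ) ≠ 0 := by positivity
  have hα' : (α : ℝ) ≠ 0 := by exact_mod_cast hα
  rw [sum_range_window_of_periodic (f := fun i => dither α T i ^ 2) fun i => by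
    rw [dither_add_period α hT]]
  set w : ℝ := 2 * π * α / T with hw
  have hw' : w = π * (2 * α / T) := by rw [hw]; ring
  have hsin : Real.sin w ≠ 0 := by
    rw [abs_lt] at hαT
    have hpi := Real.pi_pos
    refine (Real.sin_eq_zero_iff_of_lt_of_lt ?_ ?_).not.2 ?_
    · rw [hw']; nlinarith
    · rw [hw']; nlinarith
    · rw [hw]; positivity
  have hcos : ∑ i ∈ Finset.range T, Real.cos (2 * w * i) = 0 := by
    have htel := Finset.sum_range_sub (fun i : ℕ => Real.sin (2 * w * i - w)) T
    have hend : Real.sin (2 * w * T - w) = Real.sin (2 * w * (0 : ℕ) - w) := by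
      rw [← Real.sin_add_int_mul_two_pi (2 * w * (0 : ℕ) - w) (2 * α)]
      congr 1
      rw [hw]
      push_cast
      field_simp
      ring
    rw [hend, sub_self] at htel
    have hterm : ∀ i : ℕ, Real.sin (2 * w * (i + 1 : ℕ) - w) - Real.sin (2 * w * i - w)
        = 2 * Real.sin w * Real.cos (2 * w * i) := fun i => by
      rw [show 2 * w * (i + 1 : ℕ) - w = 2 * w * i + w by push_cast; ring, Real.sin_add,
        Real.sin_sub]
      ring
    simp only [hterm, ← Finset.mul_sum] at htel
    exact (mul_eq_zero.1 htel).resolve_left (mul_ne_zero two_ne_zero hsin)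
  have hsq : ∀ i : ℕ, dither α T i ^ 2 = 1 / 2 - Real.cos (2 * w * i) / 2 := fun i => by
    rw [dither, Real.sin_sq_eq_half_sub]
    congr 3
    rw [hw]
    ring
  simp only [hsq, Finset.sum_sub_distrib, ← Finset.sum_div, hcos]
  simp

lemma sum_range_reverse_cast (N : ℕ) :
    ∑ i ∈ Finset.range (N + 1), ((N : ℝ) - i) = N * (N + 1) / 2 := by
  rw [Finset.sum_sub_distrib, Finset.sum_const, Finset.card_range, nsmul_eq_mul]
  have h : ∑ i ∈ Finset.range (N + 1), (i : ℝ) = N * (N + 1) / 2 := by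
    induction N with
    | zero => simp
    | succ N ih => rw [Finset.sum_range_succ, ih]; push_cast; ring
  rw [h]
  push_cast
  ring

/-- Steps of size at most `D` bound the distance to the last point of a window. -/
lemma abs_sub_le_of_steps {x : ℕ → ℝ} {D : ℝ} {N : ℕ}
    (hx : ∀ i < N, |x (i + 1) - x i| ≤ D) {i : ℕ} (hi : i ≤ N) :
    |x N - x i| ≤ ((N : ℝ) - i) * D := by
  induction N, hi using Nat.le_induction with
  | base => simp
  | succ N hiN ih =>
    have h₁ := ih fun j hj => hx j (by omega)
    have h₂ := hx N (by omega)
    have h₃ := abs_sub_le (x (N + 1)) (x N) (x i)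
    push_cast
    linarith

lemma abs_sub_average_le {x : ℕ → ℝ} {D : ℝ} {N : ℕ} (hx : ∀ i < N, |x (i + 1) - x i| ≤ D) :
    |x N - (∑ i ∈ Finset.range (N + 1), x i) / (N + 1)| ≤ N * D / 2 := by
  have hN : (0 : ℝ) < N + 1 := by positivity
  have h : x N - (∑ i ∈ Finset.range (N + 1), x i) / (N + 1)
      = (∑ i ∈ Finset.range (N + 1), (x N - x i)) / (N + 1) := by
    rw [Finset.sum_sub_distrib, Finset.sum_const, Finset.card_range, nsmul_eq_mul]
    push_cast
    field_simp
  rw [h, abs_div, abs_of_pos hN, div_le_iff₀ hN]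
  calc |∑ i ∈ Finset.range (N + 1), (x N - x i)|
      ≤ ∑ i ∈ Finset.range (N + 1), ((N : ℝ) - i) * D :=
        (Finset.abs_sum_le_sum_abs _ _).trans <| Finset.sum_le_sum fun i hi =>
          abs_sub_le_of_steps hx (Nat.lt_succ_iff.1 (Finset.mem_range.1 hi))
    _ = N * D / 2 * (N + 1) := by
        rw [← Finset.sum_mul, sum_range_reverse_cast]; ring

/-- Averaging of the demodulated quadratic map over one dither period, with frozen-state error. -/
lemma abs_sum_demodulated_sub_le {N : ℕ} {s x : ℕ → ℝ} {a H Q σ D : ℝ} (ha : 0 ≤ a) (hH : 0 ≤ H)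
    (hs : ∀ i, |s i| ≤ 1) (hs₁ : ∑ i ∈ Finset.range (N + 1), s i ^ 1 = 0)
    (hs₂ : ∑ i ∈ Finset.range (N + 1), s i ^ 2 = ((N + 1 : ℕ) : ℝ) / 2)
    (hs₃ : ∑ i ∈ Finset.range (N + 1), s i ^ 3 = 0)
    (hσ : ∀ i ≤ N, |x i| ≤ σ) (hx : ∀ i < N, |x (i + 1) - x i| ≤ D) :
    |∑ i ∈ Finset.range (N + 1), s i * (Q + H / 2 * (x i + a * s i) ^ 2)
        - (N + 1) / 2 * a * H * x N| ≤ H * (σ + a) * D * N * (N + 1) / 2 := by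
  have hfrozen : ∑ i ∈ Finset.range (N + 1), s i * (Q + H / 2 * (x N + a * s i) ^ 2)
      = (N + 1) / 2 * a * H * x N := by
    have h : ∀ i, s i * (Q + H / 2 * (x N + a * s i) ^ 2)
        = (Q + H / 2 * x N ^ 2) * s i ^ 1 + H * a * x N * s i ^ 2 + H / 2 * a ^ 2 * s i ^ 3 :=
      fun i => by ring
    simp only [h, Finset.sum_add_distrib, ← Finset.mul_sum, hs₁, hs₂, hs₃]
    push_cast
    ring
  have hterm : ∀ i ∈ Finset.range (N + 1),
      |s i * (Q + H / 2 * (x i + a * s i) ^ 2) - s i * (Q + H / 2 * (x N + a * s i) ^ 2)|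
        ≤ H * (σ + a) * (((N : ℝ) - i) * D) := fun i hi => by
    have hiN := Nat.lt_succ_iff.1 (Finset.mem_range.1 hi)
    have hd := abs_sub_le_of_steps hx hiN
    have hsi := abs_le.1 (hs i)
    have hxi := abs_le.1 (hσ i hiN)
    have hxN := abs_le.1 (hσ N le_rfl)
    have hsum : |(x i + x N) / 2 + a * s i| ≤ σ + a := by
      rw [abs_le]; constructor <;> nlinarith
    have h : s i * (Q + H / 2 * (x i + a * s i) ^ 2) - s i * (Q + H / 2 * (x N + a * s i) ^ 2)
        = -(s i * (H * (((x i + x N) / 2 + a * s i) * (x N - x i)))) := by ring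
    rw [h, abs_neg, abs_mul, abs_mul H, abs_mul _ (x N - x i), abs_of_nonneg hH, mul_assoc H]
    have hprod := mul_le_mul hsum hd (abs_nonneg _) ((abs_nonneg _).trans hsum)
    refine (mul_le_of_le_one_left (by positivity) (hs i)).trans ?_
    exact mul_le_mul_of_nonneg_left hprod hH
  rw [← hfrozen, ← Finset.sum_sub_distrib]
  refine (Finset.abs_sum_le_sum_abs _ _).trans ((Finset.sum_le_sum hterm).trans_eq ?_)
  rw [← Finset.mul_sum, ← Finset.sum_mul, sum_range_reverse_cast]
  ring

/-- The moving average over one dither period contracts up to an error of the order of the gain. -/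
lemma abs_average_succ_le {N : ℕ} {s x : ℕ → ℝ} {a H Q σ D g : ℝ} (ha : 0 < a) (hH : 0 ≤ H)
    (hg : 0 ≤ g) (hgH : g * H ≤ 1)
    (hs : ∀ i, |s i| ≤ 1) (hs₁ : ∑ i ∈ Finset.range (N + 1), s i ^ 1 = 0)
    (hs₂ : ∑ i ∈ Finset.range (N + 1), s i ^ 2 = ((N + 1 : ℕ) : ℝ) / 2)
    (hs₃ : ∑ i ∈ Finset.range (N + 1), s i ^ 3 = 0)
    (hσ : ∀ i ≤ N, |x i| ≤ σ) (hx : ∀ i < N, |x (i + 1) - x i| ≤ D)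
    (hrec : ∀ i, x (i + 1) = x i - g * (2 / a) * s i * (Q + H / 2 * (x i + a * s i) ^ 2)) :
    |(∑ i ∈ Finset.range (N + 1), x (i + 1)) / (N + 1)|
      ≤ (1 - g * H) * |(∑ i ∈ Finset.range (N + 1), x i) / (N + 1)|
        + g * H * (D * N * ((σ + a) / a + 1 / 2)) := by
  have hN : (0 : ℝ) < N + 1 := by positivity
  have hR := abs_sum_demodulated_sub_le (Q := Q) ha.le hH hs hs₁ hs₂ hs₃ hσ hx
  have hG := abs_sub_average_le hx
  set R := ∑ i ∈ Finset.range (N + 1), s i * (Q + H / 2 * (x i + a * s i) ^ 2)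
        - (N + 1) / 2 * a * H * x N with hRdef
  set z := (∑ i ∈ Finset.range (N + 1), x i) / (N + 1) with hz
  have hsucc : (∑ i ∈ Finset.range (N + 1), x (i + 1)) / (N + 1)
      = (1 - g * H) * z + -(g * H * (x N - z)) + -(g * (2 / a) / (N + 1) * R) := by
    have h : ∑ i ∈ Finset.range (N + 1), x (i + 1) = ∑ i ∈ Finset.range (N + 1), x i
        - g * (2 / a) * ∑ i ∈ Finset.range (N + 1), s i * (Q + H / 2 * (x i + a * s i) ^ 2) := by
      rw [Finset.mul_sum, ← Finset.sum_sub_distrib]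
      exact Finset.sum_congr rfl fun i _ => by rw [hrec i]; ring
    rw [h, sub_div, ← hz, hRdef]
    field_simp
    ring
  have h₁ : |(1 - g * H) * z| = (1 - g * H) * |z| := by
    rw [abs_mul, abs_of_nonneg (sub_nonneg.2 hgH)]
  have h₂ : |-(g * H * (x N - z))| ≤ g * H * (N * D / 2) := by
    rw [abs_neg, abs_mul, abs_of_nonneg (mul_nonneg hg hH)]
    exact mul_le_mul_of_nonneg_left hG (mul_nonneg hg hH)
  have h₃ : |-(g * (2 / a) / (N + 1) * R)|
      ≤ g * (2 / a) / (N + 1) * (H * (σ + a) * D * N * (N + 1) / 2) := by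
    have hc : 0 ≤ g * (2 / a) / (N + 1) := by positivity
    rw [abs_neg, abs_mul, abs_of_nonneg hc]
    exact mul_le_mul_of_nonneg_left hR hc
  have h₄ : g * (2 / a) / (N + 1) * (H * (σ + a) * D * N * (N + 1) / 2)
      = g * H * (D * N * ((σ + a) / a)) := by field_simp
  rw [hsucc]
  have h₅ := abs_add_three ((1 - g * H) * z) (-(g * H * (x N - z))) (-(g * (2 / a) / (N + 1) * R))
  rw [h₁] at h₅
  linarith

/-- scalar discrete-time ES, improved Corollary 2. -/
theorem discrete_ES_practical_stability_scalar
    -- dither data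
    (T : ℕ) (hT : 0 < T) (α : ℤ) (hα0 : α ≠ 0) (hαT : |2 * (α : ℝ) / T| < 1)
    (a L : ℝ) (ha : 0 < a) (hL : L < 0)
    -- the unknown Hessian
    (H Hm HM : ℝ) (hHm : 0 < Hm) (hH : H ∈ Set.Icc Hm HM)
    -- the extremum value
    (Qs QM : ℝ) (hQM : 0 ≤ QM) (hQ : |Qs| ≤ QM)
    -- the constants λ and Δ
    (σ σ0 εstar lam Δ : ℝ)
    (hlam : lam = |L| * Hm)
    (hΔ : Δ = (QM + HM / 2 * (σ + a) ^ 2) * (2 * |L| / a))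
    (hσ0 : 0 < σ0) (hσ : σ0 < σ)
    (hεstar : 0 < εstar) (hlamε : lam * εstar < 1) (hεstar' : εstar * |L| * HM ≤ 1)
    (hΦ : σ0 + εstar * Δ * ((T : ℝ) - 1) * (7 * a + 2 * σ) / (2 * a) < σ)
    -- a solution of the scalar discrete ES error system for some ε ∈ (0, ε*]
    (ε : ℝ) (hε : ε ∈ Set.Ioc 0 εstar)
    (θ : ℕ → ℝ) (hθ0 : |θ 0| ≤ σ0)
    (hrec : ∀ j : ℕ, θ (j + 1) = θ j
      + ε * L * (2 / a) * Real.sin (2 * π * α * j / T)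
        * (Qs + H / 2 * (θ j + a * Real.sin (2 * π * α * j / T)) ^ 2)) :
    (∀ j : ℕ, j ≤ T - 1 → |θ j| < |θ 0| + ε * ((T : ℝ) - 1) * Δ) ∧
    (∀ j : ℕ, T - 1 ≤ j →
        |θ j| < (1 - lam * ε) ^ (j - (T - 1))
              * (|θ 0| + 3 * ((T : ℝ) - 1) * ε * Δ / 2)
            + ε * Δ * ((T : ℝ) - 1) * (2 * a + σ) / a ∧
        (1 - lam * ε) ^ (j - (T - 1))
              * (|θ 0| + 3 * ((T : ℝ) - 1) * ε * Δ / 2)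
            + ε * Δ * ((T : ℝ) - 1) * (2 * a + σ) / a < σ) := by
  obtain ⟨hε0, hεle⟩ := hε
  obtain ⟨hHl, hHu⟩ := hH
  have hLabs : |L| = -L := abs_of_neg hL
  have hLpos : 0 < |L| := abs_pos.2 hL.ne
  have hH0 : 0 < H := hHm.trans_le hHl
  have hHM0 : 0 < HM := hH0.trans_le hHu
  have hσpos : 0 < σ := hσ0.trans hσ
  have hΔ0 : 0 < Δ := by rw [hΔ]; positivity
  have hT3 : 2 < T := by
    rw [abs_div, abs_mul, Nat.abs_cast, div_lt_one (by positivity), abs_two] at hαT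
    have h₁ : (1 : ℝ) ≤ |(α : ℝ)| := by exact_mod_cast Int.one_le_abs hα0
    exact_mod_cast (by linarith : (2 : ℝ) < T)
  obtain ⟨N, rfl⟩ : ∃ N, T = N + 1 := ⟨T - 1, by omega⟩
  have hN : (0 : ℝ) < N := by exact_mod_cast (by omega : 0 < N)
  have hcast : ((N + 1 : ℕ) : ℝ) - 1 = N := by push_cast; ring
  simp only [hcast, Nat.add_sub_cancel] at hΦ ⊢
  set s := dither α (N + 1) with hs
  set g := ε * |L| with hg
  have hg0 : 0 < g := mul_pos hε0 hLpos
  have hgH : g * H ≤ 1 := by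
    refine le_trans ?_ hεstar'
    rw [hg]
    gcongr
  have hlamg : lam * ε ≤ g * H := by
    rw [hlam, hg, mul_right_comm, mul_comm |L| ε]
    gcongr
  have hlam0 : 0 < lam := by rw [hlam]; positivity
  have hq0 : 0 < 1 - lam * ε := by
    have := mul_le_mul_of_nonneg_left hεle hlam0.le
    linarith
  have hq1 : 1 - lam * ε ≤ 1 := by
    have := mul_pos hlam0 hε0
    linarith
  have hrec' : ∀ i, θ (i + 1)
      = θ i - g * (2 / a) * s i * (Qs + H / 2 * (θ i + a * s i) ^ 2) := fun i => by
    rw [hrec i, hg, hLabs, hs, dither]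
    ring
  have hstep : ∀ i, |θ i| ≤ σ → |θ (i + 1) - θ i| ≤ ε * Δ := fun i hi => by
    have hsi := abs_le.1 (abs_dither_le_one α (N + 1) i)
    have hθi := abs_le.1 hi
    have hsq : (θ i + a * s i) ^ 2 ≤ (σ + a) ^ 2 :=
      sq_le_sq' (by nlinarith) (by nlinarith)
    have hval : |Qs + H / 2 * (θ i + a * s i) ^ 2| ≤ QM + HM / 2 * (σ + a) ^ 2 := by
      refine (abs_add_le _ _).trans (add_le_add hQ ?_)
      rw [abs_of_nonneg (by positivity)]
      gcongr
    rw [hrec', sub_sub_cancel_left, abs_neg, mul_right_comm, abs_mul _ (s i), abs_mul,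
      abs_of_nonneg (by positivity : 0 ≤ g * (2 / a))]
    calc g * (2 / a) * |Qs + H / 2 * (θ i + a * s i) ^ 2| * |s i|
        ≤ g * (2 / a) * (QM + HM / 2 * (σ + a) ^ 2) * 1 := by
          gcongr
          exact abs_dither_le_one α (N + 1) i
      _ = ε * Δ := by rw [hΔ, hg]; ring
  have hεΔ : 0 < ε * Δ := mul_pos hε0 hΔ0
  have hbudget : |θ 0| + 3 * N * ε * Δ / 2 + ε * Δ * N * (2 * a + σ) / a < σ := by
    have h₁ : ε * (Δ * N * (7 * a + 2 * σ) / (2 * a))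
        ≤ εstar * (Δ * N * (7 * a + 2 * σ) / (2 * a)) := by gcongr
    have h₂ : 3 * N * ε * Δ / 2 + ε * Δ * N * (2 * a + σ) / a
        = ε * (Δ * N * (7 * a + 2 * σ) / (2 * a)) := by field_simp; ring
    have h₃ : εstar * Δ * N * (7 * a + 2 * σ) / (2 * a)
        = εstar * (Δ * N * (7 * a + 2 * σ) / (2 * a)) := by ring
    linarith
  have htail : 0 < ε * Δ * N * (2 * a + σ) / a := by positivity
  have hNεΔ : 0 < N * (ε * Δ) := mul_pos hN hεΔ
  have htransient : ∀ j < N, |θ (j + 1)| ≤ |θ 0| + j * (ε * Δ) := fun j => by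
    induction j with
    | zero => intro _; simp [hrec' 0, hs, dither_zero]
    | succ j ih =>
      intro hj
      have h₁ := ih (by omega)
      have hjN : (j : ℝ) * (ε * Δ) ≤ N * (ε * Δ) := by
        gcongr
        omega
      have h₂ := hstep (j + 1) (by linarith)
      have h₃ := abs_sub_abs_le_abs_sub (θ (j + 1 + 1)) (θ (j + 1))
      push_cast
      linarith
  have hfirst : ∀ j ≤ N, |θ j| < |θ 0| + ε * N * Δ := fun j hj => by
    rcases j with _ | j
    · linarith
    · have h₁ := htransient j hj
      have h₂ : (j : ℝ) * (ε * Δ) < N * (ε * Δ) := by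
        gcongr
        omega
      linarith
  have hfirstσ : ∀ j ≤ N, |θ j| ≤ σ := fun j hj => by
    have := hfirst j hj
    linarith
  have hfinal : ∀ n : ℕ, (1 - lam * ε) ^ n * (|θ 0| + 3 * N * ε * Δ / 2)
      + ε * Δ * N * (2 * a + σ) / a < σ := fun n => by
    have h₁ : 0 ≤ |θ 0| + 3 * N * ε * Δ / 2 := by positivity
    have h₂ := mul_le_of_le_one_left h₁ (pow_le_one₀ hq0.le hq1 : (1 - lam * ε) ^ n ≤ 1)
    linarith
  set B := ε * Δ * N * ((σ + a) / a + 1 / 2) with hB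
  have hB' : B + N * (ε * Δ) / 2 = ε * Δ * N * (2 * a + σ) / a := by
    rw [hB]; field_simp; ring
  have hdist : ∀ n : ℕ, (∀ i < n + N, |θ i| ≤ σ) →
      |θ (n + N) - (∑ i ∈ Finset.range (N + 1), θ (n + i)) / (N + 1)| ≤ N * (ε * Δ) / 2 :=
    fun n hn => abs_sub_average_le (x := fun i => θ (n + i)) fun i hi =>
      hstep (n + i) (hn _ (by omega))
  have hbound : ∀ n : ℕ, |(∑ i ∈ Finset.range (N + 1), θ (n + i)) / (N + 1)|
      ≤ (1 - lam * ε) ^ n * (|θ 0| + ε * N * Δ) + B →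
      (∀ i < n + N, |θ i| ≤ σ) →
      |θ (n + N)| < (1 - lam * ε) ^ n * (|θ 0| + 3 * N * ε * Δ / 2)
        + ε * Δ * N * (2 * a + σ) / a := fun n hz hn => by
    have h₁ := hdist n hn
    have h₂ := abs_sub_abs_le_abs_sub (θ (n + N))
      ((∑ i ∈ Finset.range (N + 1), θ (n + i)) / (N + 1))
    have h₃ : (1 - lam * ε) ^ n * (|θ 0| + ε * N * Δ)
        < (1 - lam * ε) ^ n * (|θ 0| + 3 * N * ε * Δ / 2) := by
      gcongr
      linarith
    linarith
  have hmain : ∀ n : ℕ, (∀ i ≤ n + N, |θ i| ≤ σ) ∧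
      |(∑ i ∈ Finset.range (N + 1), θ (n + i)) / (N + 1)|
        ≤ (1 - lam * ε) ^ n * (|θ 0| + ε * N * Δ) + B := by
    intro n
    induction n with
    | zero =>
      refine ⟨fun i hi => hfirstσ i (by omega), ?_⟩
      have hB0 : 0 ≤ B := by positivity
      have hNpos : (0 : ℝ) < N + 1 := by positivity
      have havg : |(∑ i ∈ Finset.range (N + 1), θ (0 + i)) / (N + 1)| ≤ |θ 0| + ε * N * Δ := by
        rw [abs_div, abs_of_pos hNpos, div_le_iff₀ hNpos]
        refine (Finset.abs_sum_le_sum_abs _ _).trans ?_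
        refine (Finset.sum_le_card_nsmul _ _ (|θ 0| + ε * N * Δ) fun i hi => ?_).trans_eq ?_
        · rw [zero_add]
          exact (hfirst i (Nat.lt_succ_iff.1 (Finset.mem_range.1 hi))).le
        · rw [Finset.card_range, nsmul_eq_mul]
          push_cast
          ring
      rw [pow_zero, one_mul]
      linarith
    | succ n ih =>
      obtain ⟨hn, hz⟩ := ih
      have hodd₁ := sum_dither_pow_of_odd α hT odd_one n
      have hodd₃ := sum_dither_pow_of_odd α hT (by decide : Odd 3) n
      have havg := abs_average_succ_le (x := fun i => θ (n + i)) (s := fun i => s (n + i))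
        ha hH0.le hg0.le hgH (fun i => abs_dither_le_one α (N + 1) (n + i)) hodd₁
        (sum_dither_sq hT hα0 hαT n) hodd₃ (fun i hi => hn _ (by omega))
        (fun i hi => hstep (n + i) (hn _ (by omega))) (fun i => hrec' (n + i))
      have hshift : ∑ i ∈ Finset.range (N + 1), θ (n + 1 + i)
          = ∑ i ∈ Finset.range (N + 1), θ (n + (i + 1)) :=
        Finset.sum_congr rfl fun i _ => by congr 1; ring
      have hz' : |(∑ i ∈ Finset.range (N + 1), θ (n + 1 + i)) / (N + 1)|
          ≤ (1 - lam * ε) ^ (n + 1) * (|θ 0| + ε * N * Δ)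
            + B := by
        rw [hshift]
        refine havg.trans ?_
        rw [← hB]
        set A := |θ 0| + ε * N * Δ with hA
        have hA0 : 0 ≤ A := by
          have := abs_nonneg (θ 0)
          linarith
        have h₁ := mul_le_mul_of_nonneg_left hz (sub_nonneg.2 hgH)
        have h₂ : (1 - g * H) * ((1 - lam * ε) ^ n * A)
            ≤ (1 - lam * ε) * ((1 - lam * ε) ^ n * A) := by gcongr
        rw [pow_succ']
        linarith
      refine ⟨fun i hi => ?_, hz'⟩
      rcases Nat.lt_or_ge i (n + 1 + N) with hlt | hge
      · exact hn i (by omega)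
      · obtain rfl : i = n + 1 + N := le_antisymm hi hge
        exact ((hbound (n + 1) hz' fun j hj => hn j (by omega)).trans (hfinal (n + 1))).le
  refine ⟨hfirst, fun j hj => ?_⟩
  obtain ⟨n, rfl⟩ : ∃ n, j = n + N := ⟨j - N, by omega⟩
  rw [Nat.add_sub_cancel]
  exact ⟨hbound n (hmain n).2 fun i hi => (hmain n).1 i hi.le, hfinal n⟩
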